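/- For every real number a, the function ξ(H,r) = (1/2)·log(H + a + √((H+a)² + r²)) is well defined and smooth on ℍ (since √((H+a)²+r²) > |H+a| when r > 0, the argument of the logarithm is positive), and it satisfies the axi-symmetric harmonic equation ∂²ξ/∂H² + ∂²ξ/∂r² + (1/r)·∂ξ/∂r = 0 at every point of ℍ. -/

import Mathlib

theorem sq_add_sq_pos_of_pos (x : ℝ) {r : ℝ} (hr : 0 < r) : 0 < x ^ 2 + r ^ 2 := by
  positivity

theorem add_sqrt_sq_add_sq_pos (x : ℝ) {r : ℝ} (hr : 0 < r) :
    0 < x + √(x ^ 2 + r ^ 2) := by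
  have h : |x| < √(x ^ 2 + r ^ 2) := by
    rw [← Real.sqrt_sq_eq_abs]
    exact Real.sqrt_lt_sqrt (sq_nonneg x) (by nlinarith)
  linarith [neg_abs_le x]

theorem hasDerivAt_sqrt_add_sq_add_sq_left (a H : ℝ) {r : ℝ} (hr : 0 < r) :
    HasDerivAt (fun H => √((H + a) ^ 2 + r ^ 2)) ((H + a) / √((H + a) ^ 2 + r ^ 2)) H := by
  have h := ((((hasDerivAt_id' H).add_const a).fun_pow 2).add_const (r ^ 2)).sqrt
    (sq_add_sq_pos_of_pos (H + a) hr).ne'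
  refine h.congr_deriv ?_
  norm_num
  field_simp

theorem hasDerivAt_sqrt_sq_add_sq_right (x : ℝ) {r : ℝ} (hr : 0 < r) :
    HasDerivAt (fun r => √(x ^ 2 + r ^ 2)) (r / √(x ^ 2 + r ^ 2)) r := by
  have h := (((hasDerivAt_id' r).fun_pow 2).const_add (x ^ 2)).sqrt
    (sq_add_sq_pos_of_pos x hr).ne'
  refine h.congr_deriv ?_
  norm_num
  field_simp

theorem hasDerivAt_half_log_add_sqrt_left (a H : ℝ) {r : ℝ} (hr : 0 < r) :
    HasDerivAt (fun H => (1 / 2) * Real.log (H + a + √((H + a) ^ 2 + r ^ 2)))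
      ((1 / 2) * (√((H + a) ^ 2 + r ^ 2))⁻¹) H := by
  have hρ := Real.sqrt_pos.2 (sq_add_sq_pos_of_pos (H + a) hr)
  have hpos := add_sqrt_sq_add_sq_pos (H + a) hr
  have h := (((((hasDerivAt_id' H).add_const a).fun_add
    (hasDerivAt_sqrt_add_sq_add_sq_left a H hr)).log hpos.ne').const_mul (1 / 2 : ℝ))
  refine h.congr_deriv ?_
  field_simp
  ring

theorem hasDerivAt_half_log_add_sqrt_right (x : ℝ) {r : ℝ} (hr : 0 < r) :
    HasDerivAt (fun r => (1 / 2) * Real.log (x + √(x ^ 2 + r ^ 2)))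
      ((1 / 2) * ((1 - x / √(x ^ 2 + r ^ 2)) / r)) r := by
  have hρ := Real.sqrt_pos.2 (sq_add_sq_pos_of_pos x hr)
  have hsq := Real.sq_sqrt (sq_add_sq_pos_of_pos x hr).le
  have hpos := add_sqrt_sq_add_sq_pos x hr
  have h := (((hasDerivAt_sqrt_sq_add_sq_right x hr).const_add x).log
    hpos.ne').const_mul (1 / 2 : ℝ)
  refine h.congr_deriv ?_
  set ρ := √(x ^ 2 + r ^ 2)
  field_simp
  linear_combination -hsq


/-- For every real `a`, the function
`ξ(H,r) = (1/2)·log(H + a + √((H+a)² + r²))` is well defined (the log argument is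
positive) and smooth on the half-plane `ℍ = {(H,r) : r > 0}`, and satisfies the
axi-symmetric harmonic equation `∂²ξ/∂H² + ∂²ξ/∂r² + (1/r)·∂ξ/∂r = 0` on `ℍ`. -/
theorem stmt_0 (a : ℝ) (ξ : ℝ → ℝ → ℝ)
    (hξ : ∀ H r : ℝ, ξ H r =
      (1/2) * Real.log (H + a + Real.sqrt ((H + a)^2 + r^2))) :
    (∀ H r : ℝ, 0 < r → 0 < H + a + Real.sqrt ((H + a)^2 + r^2)) ∧
    ContDiffOn ℝ (⊤ : ℕ∞) (fun p : ℝ × ℝ => ξ p.1 p.2) {p : ℝ × ℝ | 0 < p.2} ∧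
    (∀ H r : ℝ, 0 < r →
      deriv (fun H' => deriv (fun H'' => ξ H'' r) H') H
        + deriv (fun r' => deriv (fun r'' => ξ H r'') r') r
        + (1/r) * deriv (fun r' => ξ H r') r = 0) := by
  refine ⟨fun H r hr => add_sqrt_sq_add_sq_pos (H + a) hr, ?_, fun H r hr => ?_⟩
  · simp only [hξ]
    intro p hp
    have hsq := sq_add_sq_pos_of_pos (p.1 + a) hp
    have hpos := add_sqrt_sq_add_sq_pos (p.1 + a) hp
    refine ContDiffAt.contDiffWithinAt ?_
    refine contDiffAt_const.mul (ContDiffAt.log (ContDiffAt.add (by fun_prop)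
      (ContDiffAt.sqrt (by fun_prop) hsq.ne')) hpos.ne')
  · simp only [hξ]
    have hρ := Real.sqrt_pos.2 (sq_add_sq_pos_of_pos (H + a) hr)
    have hHH := ((hasDerivAt_sqrt_add_sq_add_sq_left a H hr).fun_inv hρ.ne').const_mul
      (1 / 2 : ℝ)
    have hrr := ((((hasDerivAt_sqrt_sq_add_sq_right (H + a) hr).fun_inv hρ.ne').const_mul
      (H + a)).const_sub 1 |>.fun_div (hasDerivAt_id' r) hr.ne').const_mul (1 / 2 : ℝ)
    have hH : (fun H' => deriv (fun H'' =>
        (1 / 2) * Real.log (H'' + a + √((H'' + a) ^ 2 + r ^ 2))) H') =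
        fun H' => (1 / 2) * (√((H' + a) ^ 2 + r ^ 2))⁻¹ :=
      funext fun H' => (hasDerivAt_half_log_add_sqrt_left a H' hr).deriv
    have hr' : (fun r' => deriv (fun r'' =>
        (1 / 2) * Real.log (H + a + √((H + a) ^ 2 + r'' ^ 2))) r') =ᶠ[nhds r]
        fun r' => (1 / 2) * ((1 - (H + a) * (√((H + a) ^ 2 + r' ^ 2))⁻¹) / r') := by
      filter_upwards [lt_mem_nhds hr] with r' h
      exact (hasDerivAt_half_log_add_sqrt_right (H + a) h).deriv
    rw [hH, hHH.deriv, hr'.deriv_eq, hrr.deriv,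
      (hasDerivAt_half_log_add_sqrt_right (H + a) hr).deriv]
    field_simp
    ring
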